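/- Let n, d ∈ ℕ with d ≥ 1, let ε > 0, and set σ = (d²/4 + d)/ε. A record is a pair t = (x, y) with x : Fin d → ℝ, |x_a| ≤ 1 for all a, and y ∈ {0,1}; a dataset is a function D : Fin n → record. For a dataset D define the coefficient vector q(D) indexed by Fin d ⊕ (Fin d × Fin d) by q(D)_a = ∑_i (1/2 − y_i)·x_{ia} and q(D)_{(a,b)} = ∑_i (1/8)·x_{ia}·x_{ib}. Let μ_D be the product measure on real vectors over this index type whose coordinate-j factor has density z ↦ (1/(2σ))·exp(−|z − q(D) j|/σ) with respect to Lebesgue measure. Then for any two datasets D, D' that agree at every index except possibly one, and every measurable set Z, μ_D(Z) ≤ exp(ε) · μ_{D'}(Z). -/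

import Mathlib

open MeasureTheory

/-- The coefficient vector of the order-2 Taylor-approximated logistic-regression
objective for a dataset `D` of records `(x, y)`: first-order coefficients
`∑_i (1/2 − y_i)·x_{ia}` and second-order coefficients `∑_i (1/8)·x_{ia}·x_{ib}`. -/
noncomputable def qLog {n d : ℕ} (D : Fin n → (Fin d → ℝ) × ℝ) :
    (Fin d ⊕ Fin d × Fin d) → ℝ
  | Sum.inl a => ∑ i, (1 / 2 - (D i).2) * (D i).1 a
  | Sum.inr (a, b) => ∑ i, (1 / 8) * ((D i).1 a * (D i).1 b)

/-- The product Laplace measure with scale `σ`, centered at `c : ι → ℝ`: the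
product measure whose coordinate-j factor has density
`z ↦ (1/(2σ))·exp(−|z − c j|/σ)` with respect to Lebesgue measure. -/
noncomputable def piLap {ι : Type*} [Fintype ι] (σ : ℝ) (c : ι → ℝ) :
    Measure (ι → ℝ) :=
  Measure.pi fun j =>
    volume.withDensity fun z => ENNReal.ofReal ((1 / (2 * σ)) * Real.exp (-|z - c j| / σ))

/-- Coordinatewise domination of measures up to finite factors passes to product measures. -/
theorem measure_pi_le_prod_smul_pi {ι : Type*} [Fintype ι] {α : ι → Type*}
    [∀ i, MeasurableSpace (α i)] {μ ν : ∀ i, Measure (α i)} {k : ι → ENNReal}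
    (hk : ∀ i, k i ≠ ⊤) (h : ∀ i, μ i ≤ k i • ν i) :
    Measure.pi μ ≤ (∏ i, k i) • Measure.pi ν := by
  have hK : ∏ i, k i ≠ ⊤ := ENNReal.prod_ne_top fun i _ => hk i
  have key : OuterMeasure.pi (fun i => (μ i).toOuterMeasure) ≤
      (∏ i, k i) • OuterMeasure.pi (fun i => (ν i).toOuterMeasure) := by
    unfold OuterMeasure.pi
    rw [OuterMeasure.smul_boundedBy hK, OuterMeasure.le_boundedBy]
    intro s
    refine (OuterMeasure.boundedBy_le s).trans ?_
    simp only [piPremeasure, Pi.smul_apply, smul_eq_mul, ← Finset.prod_mul_distrib]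
    exact Finset.prod_le_prod' fun i _ => h i _
  refine Measure.le_iff.2 fun s hs => ?_
  rw [Measure.smul_apply, Measure.pi_def, Measure.pi_def, toMeasure_apply _ _ hs,
    toMeasure_apply _ _ hs]
  exact key s

theorem laplace_density_le {σ : ℝ} (hσ : 0 < σ) (b c z : ℝ) :
    (1 / (2 * σ)) * Real.exp (-|z - b| / σ) ≤
      Real.exp (|b - c| / σ) * ((1 / (2 * σ)) * Real.exp (-|z - c| / σ)) := by
  rw [mul_left_comm, ← Real.exp_add, ← add_div]
  have := abs_sub_le z b c
  gcongr
  linarith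

/-- Moving the center of a product Laplace measure changes it by a factor of at most the
exponential of the `ℓ¹` distance divided by the scale. -/
theorem piLap_le {ι : Type*} [Fintype ι] {σ : ℝ} (hσ : 0 < σ) (b c : ι → ℝ) :
    piLap σ b ≤ ENNReal.ofReal (Real.exp ((∑ j, |b j - c j|) / σ)) • piLap σ c := by
  rw [Finset.sum_div, Real.exp_sum, ENNReal.ofReal_prod_of_nonneg fun _ _ => (Real.exp_pos _).le]
  refine measure_pi_le_prod_smul_pi (fun _ => ENNReal.ofReal_ne_top) fun j => ?_
  rw [← withDensity_smul' _ _ ENNReal.ofReal_ne_top]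
  refine withDensity_mono (Filter.Eventually.of_forall fun z => ?_)
  rw [Pi.smul_apply, smul_eq_mul, ← ENNReal.ofReal_mul (Real.exp_pos _).le]
  exact ENNReal.ofReal_le_ofReal (laplace_density_le hσ _ _ _)

theorem abs_half_sub_mul_le {x y : ℝ} (hx : |x| ≤ 1) (hy : y = 0 ∨ y = 1) :
    |(1 / 2 - y) * x| ≤ 1 / 2 := by
  have : |1 / 2 - y| = 1 / 2 := by rcases hy with rfl | rfl <;> norm_num [abs_of_nonneg, abs_of_neg]
  rw [abs_mul, this]
  linarith

theorem abs_eighth_mul_le {x x' : ℝ} (hx : |x| ≤ 1) (hx' : |x'| ≤ 1) :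
    |1 / 8 * (x * x')| ≤ 1 / 8 := by
  rw [abs_mul, abs_mul, abs_of_pos (by norm_num : (0 : ℝ) < 1 / 8)]
  linarith [mul_le_one₀ hx (abs_nonneg x') hx']

/-- Sums of terms bounded by `B` that agree off one index differ by at most `2 * B`. -/
theorem abs_sum_sub_sum_le {ι : Type*} [Fintype ι] {f g : ι → ℝ} {B : ℝ} (r : ι)
    (hf : |f r| ≤ B) (hg : |g r| ≤ B) (h : ∀ i, i ≠ r → f i = g i) :
    |∑ i, f i - ∑ i, g i| ≤ 2 * B := by
  rw [← Finset.sum_sub_distrib, Fintype.sum_eq_single r fun i hi => sub_eq_zero.2 (h i hi)]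
  linarith [abs_sub (f r) (g r)]

/-- The `ℓ¹` sensitivity of the logistic-regression coefficients is at most `d² / 4 + d`. -/
theorem sum_abs_qLog_sub_le {n d : ℕ} {D D' : Fin n → (Fin d → ℝ) × ℝ} (r : Fin n)
    (hD : (∀ a, |(D r).1 a| ≤ 1) ∧ ((D r).2 = 0 ∨ (D r).2 = 1))
    (hD' : (∀ a, |(D' r).1 a| ≤ 1) ∧ ((D' r).2 = 0 ∨ (D' r).2 = 1))
    (hagree : ∀ i, i ≠ r → D i = D' i) :
    ∑ j, |qLog D j - qLog D' j| ≤ (d : ℝ) ^ 2 / 4 + d := by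
  have h₁ : ∀ a, |qLog D (Sum.inl a) - qLog D' (Sum.inl a)| ≤ 2 * (1 / 2) := fun a =>
    abs_sum_sub_sum_le r (abs_half_sub_mul_le (hD.1 a) hD.2) (abs_half_sub_mul_le (hD'.1 a) hD'.2)
      fun i hi => by rw [hagree i hi]
  have h₂ : ∀ p, |qLog D (Sum.inr p) - qLog D' (Sum.inr p)| ≤ 2 * (1 / 8) := fun p =>
    abs_sum_sub_sum_le r (abs_eighth_mul_le (hD.1 p.1) (hD.1 p.2))
      (abs_eighth_mul_le (hD'.1 p.1) (hD'.1 p.2)) fun i hi => by rw [hagree i hi]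
  rw [Fintype.sum_sum_type]
  refine (add_le_add (Finset.sum_le_sum fun a _ => h₁ a)
    (Finset.sum_le_sum fun p _ => h₂ p)).trans_eq ?_
  simp only [Finset.sum_const, Finset.card_univ, Fintype.card_prod, Fintype.card_fin, nsmul_eq_mul]
  push_cast
  ring

/-- Theorem 1 of the paper instantiated for logistic regression (order-2 Taylor
approximation): perturbing the coefficient vector `qLog D` with independent
Laplace noise of scale `σ = (d²/4 + d)/ε` on each coordinate yields
ε-differential privacy with respect to a change of one record (with features in
[−1,1] and label in {0,1}). -/
theorem functional_mechanism_logistic_regression (n d : ℕ) (hd : 1 ≤ d)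
    (ε : ℝ) (hε : 0 < ε) (σ : ℝ) (hσ : σ = ((d : ℝ) ^ 2 / 4 + (d : ℝ)) / ε)
    (D D' : Fin n → (Fin d → ℝ) × ℝ)
    (hD : ∀ i, (∀ a, |(D i).1 a| ≤ 1) ∧ ((D i).2 = 0 ∨ (D i).2 = 1))
    (hD' : ∀ i, (∀ a, |(D' i).1 a| ≤ 1) ∧ ((D' i).2 = 0 ∨ (D' i).2 = 1))
    (r : Fin n) (hagree : ∀ i, i ≠ r → D i = D' i)
    (Z : Set ((Fin d ⊕ Fin d × Fin d) → ℝ)) (hZ : MeasurableSet Z) :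
    piLap σ (qLog D) Z ≤ ENNReal.ofReal (Real.exp ε) * piLap σ (qLog D') Z := by
  have hΔ : 0 < (d : ℝ) ^ 2 / 4 + d := by positivity
  have hσ_pos : 0 < σ := hσ ▸ div_pos hΔ hε
  refine (piLap_le hσ_pos (qLog D) (qLog D') Z).trans ?_
  rw [Measure.smul_apply, smul_eq_mul]
  gcongr
  rw [div_le_iff₀ hσ_pos, hσ, mul_div_cancel₀ _ hε.ne']
  exact sum_abs_qLog_sub_le r (hD r) (hD' r) hagree
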